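/- arXiv:math/0304261 — 3 statements merged into one kernel-verified Lean document; each statement's English description precedes it below -/
import Mathlib

section
/- Let u : ℝ³ → ℝ be a positive C² function which is superharmonic on all of ℝ³ (Δu ≤ 0), harmonic outside some compact set, and which admits the expansion u(x) = a + b/|x| + O(1/|x|²) as |x| → ∞ for constants a > 0 and b ∈ ℝ (i.e. there exist C, R > 0 with |u(x) − a − b/|x|| ≤ C/|x|² for |x| ≥ R). Then b ≥ 0, and consequently the total mass m = 2ab of the conformally flat manifold (ℝ³, u⁴δ) is nonnegative. -/
open Real Filter MeasureTheory

/-- The Euclidean Laplacian of `f : ℝⁿ → ℝ`, as the sum of the pure second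
partial derivatives in the coordinate directions. -/
noncomputable def laplacian {n : ℕ} (f : EuclideanSpace ℝ (Fin n) → ℝ)
    (x : EuclideanSpace ℝ (Fin n)) : ℝ :=
  ∑ i : Fin n,
    fderiv ℝ (fun y => fderiv ℝ f y (EuclideanSpace.single i (1 : ℝ))) x
      (EuclideanSpace.single i (1 : ℝ))

/-- Second derivative test (necessary condition) at a local minimum. -/
theorem second_deriv_nonneg_of_isLocalMin (g : ℝ → ℝ) (hc : ContinuousAt g 0)
    (h : IsLocalMin g 0) : 0 ≤ deriv (deriv g) 0 := by
  by_contra hn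
  push Not at hn
  have hmax := isLocalMax_of_deriv_deriv_neg hn h.deriv_eq_zero hc
  have he : g =ᶠ[nhds 0] fun _ => g 0 := by
    filter_upwards [h, hmax] with t h1 h2
    exact le_antisymm h2 h1
  have h2 := he.deriv.deriv.eq_of_nhds
  rw [h2] at hn
  simp at hn

theorem pure_second_partial_ge (u : EuclideanSpace ℝ (Fin 3) → ℝ) (hu : ContDiff ℝ 2 u)
    (ε : ℝ) (x e : EuclideanSpace ℝ (Fin 3)) (he : ‖e‖ = 1)
    (hmin : IsLocalMin (fun y => u y - ε * ‖y‖ ^ 2) x) :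
    2 * ε ≤ fderiv ℝ (fun y => fderiv ℝ u y e) x e := by
  have hline : ∀ t : ℝ, HasDerivAt (fun t : ℝ => x + t • e) e t := by
    intro t
    simpa using ((hasDerivAt_id t).smul_const e).const_add x
  have hud : Differentiable ℝ u := hu.differentiable (by norm_num)
  have hfd : Differentiable ℝ (fun y => fderiv ℝ u y e) :=
    ((hu.fderiv_right (m := 1) (by norm_num)).differentiable (by norm_num)).clm_apply
      (differentiable_const e)
  have hnorm : ∀ t : ℝ, ‖x + t • e‖ ^ 2 = ‖x‖ ^ 2 + 2 * t * inner ℝ x e + t ^ 2 := by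
    intro t
    rw [norm_add_sq_real, inner_smul_right, norm_smul, he, mul_one, Real.norm_eq_abs, sq_abs]
    ring
  have hq : ∀ t : ℝ, HasDerivAt (fun t : ℝ => ε * ‖x + t • e‖ ^ 2)
      (ε * (2 * inner ℝ x e + 2 * t)) t := by
    intro t
    have hfun : (fun t : ℝ => ε * ‖x + t • e‖ ^ 2) =
        fun t : ℝ => ε * (‖x‖ ^ 2 + 2 * t * inner ℝ x e + t ^ 2) :=
      funext fun t => by rw [hnorm]
    rw [hfun]
    have h1 := ((((hasDerivAt_id t).const_mul 2).mul_const (inner ℝ x e)).const_add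
      (‖x‖ ^ 2)).add ((hasDerivAt_id t).pow 2)
    have h2 : HasDerivAt (fun t : ℝ => ε * (‖x‖ ^ 2 + 2 * t * inner ℝ x e + t ^ 2)) _ t :=
      h1.const_mul ε
    refine h2.congr_deriv ?_
    simp
  have hg : ∀ t : ℝ, HasDerivAt (fun t : ℝ => u (x + t • e) - ε * ‖x + t • e‖ ^ 2)
      (fderiv ℝ u (x + t • e) e - ε * (2 * inner ℝ x e + 2 * t)) t := by
    intro t
    exact ((hud _).hasFDerivAt.comp_hasDerivAt t (hline t)).sub (hq t)
  have hg' : HasDerivAt (fun t : ℝ => fderiv ℝ u (x + t • e) e - ε * (2 * inner ℝ x e + 2 * t))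
      (fderiv ℝ (fun y => fderiv ℝ u y e) (x + (0:ℝ) • e) e - ε * 2) 0 := by
    have h1 := (hfd (x + (0:ℝ) • e)).hasFDerivAt.comp_hasDerivAt (0:ℝ) (hline 0)
    have h2 := (((hasDerivAt_id (0:ℝ)).const_mul 2).const_add (2 * inner ℝ x e)).const_mul ε
    simp only [mul_one] at h2
    exact h1.sub h2
  have hlm : IsLocalMin (fun t : ℝ => u (x + t • e) - ε * ‖x + t • e‖ ^ 2) 0 := by
    have hc : Tendsto (fun t : ℝ => x + t • e) (nhds 0) (nhds x) := by
      simpa using (hline 0).continuousAt.tendsto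
    have := hc.eventually hmin
    filter_upwards [this] with t ht
    simpa using ht
  have key := second_deriv_nonneg_of_isLocalMin _ (hg 0).continuousAt hlm
  have hd : deriv (fun t : ℝ => u (x + t • e) - ε * ‖x + t • e‖ ^ 2) =
      fun t : ℝ => fderiv ℝ u (x + t • e) e - ε * (2 * inner ℝ x e + 2 * t) :=
    funext fun t => (hg t).deriv
  rw [hd, hg'.deriv] at key
  simp only [zero_smul, add_zero] at key
  linarith

theorem laplacian_pos_of_isLocalMin (u : EuclideanSpace ℝ (Fin 3) → ℝ) (hu : ContDiff ℝ 2 u)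
    (ε : ℝ) (hε : 0 < ε) (x : EuclideanSpace ℝ (Fin 3))
    (hmin : IsLocalMin (fun y => u y - ε * ‖y‖ ^ 2) x) : 0 < laplacian u x := by
  unfold laplacian
  refine Finset.sum_pos (fun i _ => ?_) Finset.univ_nonempty
  have := pure_second_partial_ge u hu ε x (EuclideanSpace.single i (1:ℝ)) (by simp) hmin
  linarith

/-- Positive mass theorem for conformally flat, harmonically flat metrics `u⁴δ` on `ℝ³`:
if `u > 0` is `C²`, superharmonic everywhere, harmonic outside a compact set, and
`u(x) = a + b/|x| + O(1/|x|²)` at infinity with `a > 0`, then `b ≥ 0` and the total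
mass `m = 2ab` is nonnegative. -/
theorem superharmonic_expansion_coeff_nonneg
    (u : EuclideanSpace ℝ (Fin 3) → ℝ) (a b : ℝ)
    (hu : ContDiff ℝ 2 u)
    (hpos : ∀ x, 0 < u x)
    (hsuper : ∀ x, laplacian u x ≤ 0)
    (hharm : ∃ K : Set (EuclideanSpace ℝ (Fin 3)), IsCompact K ∧
      ∀ x ∉ K, laplacian u x = 0)
    (ha : 0 < a)
    (hexp : ∃ C > (0:ℝ), ∃ R > (0:ℝ), ∀ x : EuclideanSpace ℝ (Fin 3),
      R ≤ ‖x‖ → |u x - a - b / ‖x‖| ≤ C / ‖x‖ ^ 2) :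
    0 ≤ b ∧ 0 ≤ 2 * a * b := by
  suffices hb : 0 ≤ b from ⟨hb, by positivity⟩
  by_contra hb
  push Not at hb
  obtain ⟨C, hC, R, hR, hexp⟩ := hexp
  have hsph : ∀ r : ℝ, 0 ≤ r → ‖EuclideanSpace.single (0 : Fin 3) r‖ = r := by
    intro r hr
    simp [abs_of_nonneg hr]
  -- a point where `u < a`
  obtain ⟨ρ, hρR, hρC⟩ : ∃ ρ : ℝ, R ≤ ρ ∧ C < -b * ρ := by
    refine ⟨R + C / (-b), ?_, ?_⟩
    · have : 0 < C / (-b) := div_pos hC (by linarith)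
      linarith
    · have h1 : -b * (R + C / (-b)) = -b * R + C := by
        field_simp [hb.ne]
        ring
      have : 0 < -b * R := mul_pos (by linarith) hR
      linarith
  have hρ : 0 < ρ := by linarith
  obtain ⟨x₀, hx₀⟩ : ∃ x₀ : EuclideanSpace ℝ (Fin 3), ‖x₀‖ = ρ := ⟨_, hsph ρ hρ.le⟩
  have hlow : u x₀ < a := by
    have h1 := (abs_le.1 (hexp x₀ (by rw [hx₀]; exact hρR))).2
    rw [hx₀] at h1
    have h2 : b / ρ + C / ρ ^ 2 = (b * ρ + C) / ρ ^ 2 := by field_simp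
    have h3 : (b * ρ + C) / ρ ^ 2 < 0 := div_neg_of_neg_of_pos (by linarith) (by positivity)
    linarith
  obtain ⟨δ, hδ, hδu⟩ : ∃ δ : ℝ, 0 < δ ∧ u x₀ = a - 2 * δ :=
    ⟨(a - u x₀) / 2, by linarith, by ring⟩
  -- a large sphere on which `u ≥ a - δ`
  obtain ⟨r, hr1, hrR, hrρ, hrδ⟩ : ∃ r : ℝ, 1 ≤ r ∧ R ≤ r ∧ ρ < r ∧ -b + C ≤ δ * r := by
    have h0 : 0 < (-b + C) / δ := div_pos (by linarith) hδ
    refine ⟨ρ + 1 + (-b + C) / δ, by linarith, by linarith, by linarith, ?_⟩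
    have h1 : δ * (ρ + 1 + (-b + C) / δ) = δ * (ρ + 1) + (-b + C) := by field_simp
    have h2 : 0 < δ * (ρ + 1) := by positivity
    linarith
  have hr : 0 < r := by linarith
  have hbd : ∀ y : EuclideanSpace ℝ (Fin 3), ‖y‖ = r → a - δ ≤ u y := by
    intro y hy
    have h1 := (abs_le.1 (hexp y (by rw [hy]; exact hrR))).1
    rw [hy] at h1
    have h2 : C / r ^ 2 ≤ C / r := by
      apply div_le_div_of_nonneg_left hC.le hr
      nlinarith
    have h3 : (-b + C) / r ≤ δ := (div_le_iff₀ hr).2 hrδ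
    have h4 : (-b + C) / r = -(b / r) + C / r := by ring
    linarith
  -- interior minimum of the perturbed function
  obtain ⟨ε, hε, hεr⟩ : ∃ ε : ℝ, 0 < ε ∧ ε * r ^ 2 = δ / 2 :=
    ⟨δ / 2 / r ^ 2, by positivity, by field_simp⟩
  have hcont : Continuous (fun y => u y - ε * ‖y‖ ^ 2) := by
    have := hu.continuous
    fun_prop
  obtain ⟨z, hz, hzmin⟩ := (isCompact_closedBall (0 : EuclideanSpace ℝ (Fin 3)) r).exists_isMinOn
    ⟨0, by simp [hr.le]⟩ hcont.continuousOn
  have hz0 : u z - ε * ‖z‖ ^ 2 ≤ u x₀ - ε * ‖x₀‖ ^ 2 :=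
    hzmin (by simp [hx₀, hrρ.le])
  have hzr : ‖z‖ < r := by
    refine lt_of_le_of_ne (by simpa using hz) fun h => ?_
    have h1 := hbd z h
    rw [h, hεr] at hz0
    have : 0 ≤ ε * ‖x₀‖ ^ 2 := by positivity
    linarith
  have hloc : IsLocalMin (fun y => u y - ε * ‖y‖ ^ 2) z :=
    hzmin.isLocalMin (Metric.closedBall_mem_nhds_of_mem (by simpa using hzr))
  exact absurd (laplacian_pos_of_isLocalMin u hu ε hε z hloc) (not_lt.2 (hsuper z))
end

section
/- Let R > 0 and let h be a harmonic function on {x ∈ ℝ³ : |x| > R} with lim_{|x|→∞} h(x) = a. Then there exist a constant b ∈ ℝ and a constant C > 0 such that for all |x| ≥ 2R one has |h(x) − a − b/|x|| ≤ C/|x|² and |∇(h − a − b/|x|)(x)| ≤ C/|x|³. -/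
open Real Filter MeasureTheory

abbrev E3 := EuclideanSpace ℝ (Fin 3)

lemma aux_green (u w : E3 → ℝ) (hu : ContDiff ℝ 2 u) (hw : ContDiff ℝ 2 w)
    (hc : HasCompactSupport w) :
    ∫ y, u y * laplacian w y = ∫ y, laplacian u y * w y := by
  have d1 : ∀ f : E3 → ℝ, ContDiff ℝ 2 f → ∀ i : Fin 3,
      ContDiff ℝ 1 (fun y => fderiv ℝ f y (EuclideanSpace.single i (1 : ℝ))) := by
    intro f hf i
    exact (hf.fderiv_right (m := 1) (by norm_num)).clm_apply contDiff_const
  have d2 : ∀ f : E3 → ℝ, ContDiff ℝ 1 f → ∀ i : Fin 3,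
      Continuous (fun y => fderiv ℝ f y (EuclideanSpace.single i (1 : ℝ))) := by
    intro f hf i
    exact (hf.continuous_fderiv (by norm_num)).clm_apply continuous_const
  have c1 : ∀ i : Fin 3,
      HasCompactSupport (fun y => fderiv ℝ w y (EuclideanSpace.single i (1 : ℝ))) :=
    fun i => hc.fderiv_apply ℝ _
  have c2 : ∀ i : Fin 3,
      HasCompactSupport (fun y => fderiv ℝ (fun y => fderiv ℝ w y
        (EuclideanSpace.single i (1 : ℝ))) y (EuclideanSpace.single i (1 : ℝ))) :=
    fun i => (c1 i).fderiv_apply ℝ _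
  have key : ∀ i : Fin 3,
      ∫ y, u y * fderiv ℝ (fun y => fderiv ℝ w y
        (EuclideanSpace.single i (1 : ℝ))) y (EuclideanSpace.single i (1 : ℝ)) =
      ∫ y, fderiv ℝ (fun y => fderiv ℝ u y
        (EuclideanSpace.single i (1 : ℝ))) y (EuclideanSpace.single i (1 : ℝ)) * w y := by
    intro i
    have cw1 := (d1 w hw i).continuous
    have cu1 := (d1 u hu i).continuous
    have cw2 := d2 _ (d1 w hw i) i
    have cu2 := d2 _ (d1 u hu i) i
    have cu := hu.continuous
    have cw := hw.continuous
    rw [integral_mul_fderiv_eq_neg_fderiv_mul_of_integrable]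
    · rw [integral_mul_fderiv_eq_neg_fderiv_mul_of_integrable]
      · simp
      · exact (cu2.mul cw).integrable_of_hasCompactSupport hc.mul_left
      · exact (cu1.mul cw1).integrable_of_hasCompactSupport (c1 i).mul_left
      · exact (cu1.mul cw).integrable_of_hasCompactSupport hc.mul_left
      · exact fun z _ => (d1 u hu i).differentiable (by norm_num) z
      · exact fun z _ => hw.differentiable (by norm_num) z
    · exact (cu1.mul cw1).integrable_of_hasCompactSupport (c1 i).mul_left
    · exact (cu.mul cw2).integrable_of_hasCompactSupport (c2 i).mul_left
    · exact (cu.mul cw1).integrable_of_hasCompactSupport (c1 i).mul_left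
    · exact fun z _ => hu.differentiable (by norm_num) z
    · exact fun z _ => (d1 w hw i).differentiable (by norm_num) z
  simp only [laplacian, Finset.mul_sum, Finset.sum_mul]
  rw [integral_finsetSum, integral_finsetSum]
  · exact Finset.sum_congr rfl fun i _ => key i
  · intro i _
    exact ((d2 _ (d1 u hu i) i).mul hw.continuous).integrable_of_hasCompactSupport hc.mul_left
  · intro i _
    exact (hu.continuous.mul (d2 _ (d1 w hw i) i)).integrable_of_hasCompactSupport (c2 i).mul_left

lemma aux_radial (x : E3) (g g' g'' : ℝ → ℝ) (h1 : ∀ s, HasDerivAt g (g' s) s)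
    (h2 : ∀ s, HasDerivAt g' (g'' s) s) (y : E3) :
    laplacian (fun y => g (‖y - x‖ ^ 2)) y
      = 6 * g' (‖y - x‖ ^ 2) + 4 * ‖y - x‖ ^ 2 * g'' (‖y - x‖ ^ 2) := by
  have hn : ∀ y : E3, HasFDerivAt (fun y : E3 => ‖y - x‖ ^ 2) (2 • innerSL ℝ (y - x)) y := by
    intro y
    simpa using ((hasFDerivAt_id y).sub_const x).norm_sq
  have hi : ∀ (y : E3) (i : Fin 3),
      (2 • innerSL ℝ (y - x)) (EuclideanSpace.single i (1:ℝ)) = 2 * (y i - x i) := by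
    intro y i
    simp [EuclideanSpace.inner_single_right]
  have e1 : ∀ (y : E3) (i : Fin 3), fderiv ℝ (fun y => g (‖y - x‖ ^ 2)) y
      (EuclideanSpace.single i (1 : ℝ)) = g' (‖y - x‖ ^ 2) * (2 * (y i - x i)) := by
    intro y i
    have hh : HasFDerivAt (fun y => g (‖y - x‖ ^ 2)) _ y := (h1 _).comp_hasFDerivAt y (hn y)
    rw [hh.fderiv, _root_.smul_apply, hi, smul_eq_mul]
  have e2 : ∀ (i : Fin 3), fderiv ℝ (fun y : E3 => g' (‖y - x‖ ^ 2) * (2 * (y i - x i))) y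
      (EuclideanSpace.single i (1 : ℝ)) = g'' (‖y - x‖ ^ 2) * (2 * (y i - x i)) ^ 2
        + 2 * g' (‖y - x‖ ^ 2) := by
    intro i
    have hp : HasFDerivAt (fun y : E3 => 2 * (y i - x i))
        ((2:ℝ) • (EuclideanSpace.proj i : E3 →L[ℝ] ℝ)) y := by
      have := (((EuclideanSpace.proj i : E3 →L[ℝ] ℝ).hasFDerivAt (x := y)).sub_const (x i)).const_mul 2
      simpa using this
    have hh : HasFDerivAt (fun y : E3 => g' (‖y - x‖ ^ 2) * (2 * (y i - x i))) _ y :=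
      ((h2 _).comp_hasFDerivAt y (hn y)).mul hp
    rw [hh.fderiv]
    simp only [_root_.add_apply, _root_.smul_apply, hi, smul_eq_mul, Function.comp]
    simp
    ring
  unfold laplacian
  simp only [e1, e2]
  rw [EuclideanSpace.norm_sq_eq]
  simp only [Fin.sum_univ_three, PiLp.sub_apply, Real.norm_eq_abs, sq_abs]
  ring

lemma aux_profile (l : ℝ → ℝ) (δ : ℝ) (hδ : 0 < δ) (hl : ContDiff ℝ 2 l)
    (h0 : ∀ s < δ, l s = 0) :
    ContDiff ℝ 2 (fun s => l s / √s) ∧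
    ∃ g' g'' : ℝ → ℝ, (∀ s, HasDerivAt (fun s => l s / √s) (g' s) s) ∧
      (∀ s, HasDerivAt g' (g'' s) s) ∧
      ∀ s, 6 * g' s + 4 * s * g'' s = (2 * deriv l s + 4 * s * deriv (deriv l) s) / √s := by
  have hC : ContDiff ℝ 2 (fun s => l s / √s) := by
    rw [contDiff_iff_contDiffAt]
    intro s
    rcases lt_or_ge s δ with hs | hs
    · have : (fun s => l s / √s) =ᶠ[nhds s] fun _ => 0 := by
        filter_upwards [eventually_lt_nhds hs] with t ht
        simp [h0 t ht]
      exact contDiffAt_const.congr_of_eventuallyEq this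
    · have hs0 : s ≠ 0 := by linarith
      exact hl.contDiffAt.div (contDiffAt_id.sqrt hs0) (Real.sqrt_ne_zero'.2 (by linarith))
  refine ⟨hC, deriv (fun s => l s / √s), deriv (deriv (fun s => l s / √s)), ?_, ?_, ?_⟩
  · intro s
    exact (hC.differentiable (by norm_num) s).hasDerivAt
  · intro s
    have : ContDiff ℝ 1 (deriv (fun s => l s / √s)) := by
      exact ((contDiff_succ_iff_deriv (n := 1)).1 (by simpa [one_add_one_eq_two] using hC)).2.2
    exact (this.differentiable (by norm_num) s).hasDerivAt
  · intro s
    have hl' : ContDiff ℝ 1 (deriv l) :=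
      ((contDiff_succ_iff_deriv (n := 1)).1 (by simpa [one_add_one_eq_two] using hl)).2.2
    rcases lt_or_ge s δ with hs | hs
    · have z0 : l =ᶠ[nhds s] fun _ => 0 := by
        filter_upwards [eventually_lt_nhds hs] with t ht
        simp [h0 t ht]
      have z : (fun s => l s / √s) =ᶠ[nhds s] fun _ => 0 := by
        filter_upwards [z0] with t ht
        simp [ht]
      have a1 := z0.deriv.eq_of_nhds
      have a2 := z0.deriv.deriv.eq_of_nhds
      have a3 := z.deriv.eq_of_nhds
      have a4 := z.deriv.deriv.eq_of_nhds
      rw [a1, a2, a3, a4]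
      simp
    · have hs0 : 0 < s := by linarith
      have f1 : ∀ t, 0 < t → HasDerivAt (fun s => l s / √s)
          ((deriv l t * √t - l t * (1 / (2 * √t))) / (√t) ^ 2) t := by
        intro t ht
        exact (hl.differentiable (by norm_num) t).hasDerivAt.div (Real.hasDerivAt_sqrt ht.ne')
          (Real.sqrt_ne_zero'.2 ht)
      have f2 : deriv (fun s => l s / √s) =ᶠ[nhds s]
          fun t => deriv l t / √t - l t / (2 * (t * √t)) := by
        filter_upwards [eventually_gt_nhds hs0] with t ht
        rw [(f1 t ht).deriv]
        have : √t ≠ 0 := Real.sqrt_ne_zero'.2 ht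
        have h3 : √t ^ 2 = t := Real.sq_sqrt ht.le
        generalize √t = q at *
        subst h3
        field_simp
      have hq : √s ≠ 0 := Real.sqrt_ne_zero'.2 hs0
      have f3 := ((hl'.differentiable (by norm_num) s).hasDerivAt.div
        (Real.hasDerivAt_sqrt hs0.ne') hq).sub
        ((hl.differentiable (by norm_num) s).hasDerivAt.div
          (((hasDerivAt_id s).mul (Real.hasDerivAt_sqrt hs0.ne')).const_mul 2)
          (by simp only [id, Pi.mul_apply]; positivity))
      have f4 := f2.deriv_eq.trans (HasDerivAt.deriv f3)
      rw [f4, f2.eq_of_nhds]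
      simp only [id, Pi.mul_apply]
      have h3 : √s ^ 2 = s := Real.sq_sqrt hs0.le
      generalize deriv (deriv l) s = A
      generalize deriv l s = B
      generalize l s = D
      generalize √s = q at *
      subst h3
      field_simp
      ring

/-- smooth cutoff profile -/
noncomputable def kk (s : ℝ) : ℝ := Real.smoothTransition (2 - s)

/-- the radial kernel obtained from the cutoff -/
noncomputable def QQ (s : ℝ) : ℝ := (2 * deriv kk s + 4 * s * deriv (deriv kk) s) / √s

lemma kk_contDiff : ContDiff ℝ 2 kk := by
  unfold kk
  exact (Real.smoothTransition.contDiff (n := 2)).comp (contDiff_const.sub contDiff_id)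

lemma kk_one {s : ℝ} (hs : s ≤ 1) : kk s = 1 :=
  Real.smoothTransition.one_of_one_le (by linarith)

lemma kk_zero {s : ℝ} (hs : 2 ≤ s) : kk s = 0 :=
  Real.smoothTransition.zero_of_nonpos (by linarith)

lemma dkk_contDiff : ContDiff ℝ 1 (deriv kk) :=
  ((contDiff_succ_iff_deriv (n := 1)).1 (by simpa [one_add_one_eq_two] using kk_contDiff)).2.2

lemma ddkk_cont : Continuous (deriv (deriv kk)) := dkk_contDiff.continuous_deriv (by norm_num)

lemma kk_hasDeriv (s : ℝ) : HasDerivAt kk (deriv kk s) s :=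
  (kk_contDiff.differentiable (by norm_num) s).hasDerivAt

lemma dkk_hasDeriv (s : ℝ) : HasDerivAt (deriv kk) (deriv (deriv kk) s) s :=
  (dkk_contDiff.differentiable (by norm_num) s).hasDerivAt

lemma kk_small {s : ℝ} (hs : s < 1) : deriv kk s = 0 ∧ deriv (deriv kk) s = 0 := by
  have z0 : kk =ᶠ[nhds s] fun _ => 1 := by
    filter_upwards [eventually_lt_nhds hs] with t ht
    exact kk_one ht.le
  have a1 := z0.deriv.eq_of_nhds
  have a2 := z0.deriv.deriv.eq_of_nhds
  rw [a1, a2]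
  simp

lemma kk_large {s : ℝ} (hs : 2 < s) : deriv kk s = 0 ∧ deriv (deriv kk) s = 0 := by
  have z0 : kk =ᶠ[nhds s] fun _ => 0 := by
    filter_upwards [eventually_gt_nhds hs] with t ht
    exact kk_zero ht.le
  have a1 := z0.deriv.eq_of_nhds
  have a2 := z0.deriv.deriv.eq_of_nhds
  rw [a1, a2]
  simp

lemma QQ_small {s : ℝ} (hs : s < 1) : QQ s = 0 := by
  simp [QQ, kk_small hs]

lemma QQ_large {s : ℝ} (hs : 2 < s) : QQ s = 0 := by
  simp [QQ, kk_large hs]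

lemma QQ_cont : Continuous QQ := by
  rw [continuous_iff_continuousAt]
  intro s
  rcases lt_or_ge s 1 with hs | hs
  · have : QQ =ᶠ[nhds s] fun _ => 0 := by
      filter_upwards [eventually_lt_nhds hs] with t ht
      exact QQ_small ht
    exact continuousAt_const.congr this.symm
  · unfold QQ
    refine ContinuousAt.div ?_ Real.continuous_sqrt.continuousAt (Real.sqrt_ne_zero'.2 (by linarith))
    have h1 := dkk_contDiff.continuous
    have h2 := ddkk_cont
    fun_prop

lemma QQn_cont : Continuous (fun z : E3 => QQ (‖z‖ ^ 2)) :=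
  QQ_cont.comp (by fun_prop)

lemma QQn_supp : HasCompactSupport (fun z : E3 => QQ (‖z‖ ^ 2)) := by
  refine HasCompactSupport.intro (isCompact_closedBall (0 : E3) 2) ?_
  intro z hz
  simp only [Metric.mem_closedBall, dist_zero_right, not_le] at hz
  exact QQ_large (by nlinarith)

lemma QQn_int : Integrable (fun z : E3 => QQ (‖z‖ ^ 2)) :=
  QQn_cont.integrable_of_hasCompactSupport QQn_supp

lemma QQ_pos : 0 < ∫ z : E3, QQ (‖z‖ ^ 2) := by
  rw [integral_fun_norm_addHaar volume (fun r => QQ (r ^ 2))]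
  have hd : ∀ r ∈ Set.Ici (0:ℝ), HasDerivAt (fun r => 2 * r ^ 2 * deriv kk (r ^ 2) - kk (r ^ 2))
      (r ^ 2 * QQ (r ^ 2)) r := by
    intro r hr
    have hr : 0 ≤ r := hr
    have p : HasDerivAt (fun r : ℝ => r ^ 2) (2 * r) r := by simpa using hasDerivAt_pow 2 r
    have h1 : HasDerivAt (fun r : ℝ => kk (r ^ 2)) (deriv kk (r ^ 2) * (2 * r)) r :=
      HasDerivAt.comp (h₂ := kk) r (kk_hasDeriv (r ^ 2)) p
    have h2 : HasDerivAt (fun r : ℝ => deriv kk (r ^ 2)) (deriv (deriv kk) (r ^ 2) * (2 * r)) r :=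
      HasDerivAt.comp (h₂ := deriv kk) r (dkk_hasDeriv (r ^ 2)) p
    have h3 := ((p.const_mul 2).mul h2).sub h1
    refine HasDerivAt.congr_deriv h3 ?_
    unfold QQ
    rw [Real.sqrt_sq hr]
    rcases hr.eq_or_lt with rfl | hr
    · simp
    · field_simp
      ring
  have hlim : Tendsto (fun r : ℝ => 2 * r ^ 2 * deriv kk (r ^ 2) - kk (r ^ 2)) atTop (nhds 0) := by
    refine tendsto_const_nhds.congr' ?_
    filter_upwards [eventually_gt_atTop 2] with r hr
    rw [(kk_large (by nlinarith : 2 < r ^ 2)).1, kk_zero (by nlinarith : 2 ≤ r ^ 2)]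
    simp
  have hint : IntegrableOn (fun r : ℝ => r ^ 2 * QQ (r ^ 2)) (Set.Ioi 0) := by
    refine (Continuous.integrable_of_hasCompactSupport (μ := volume) ?_ ?_).integrableOn
    · exact (continuous_pow 2).mul (QQ_cont.comp (continuous_pow 2))
    · refine HasCompactSupport.intro (isCompact_closedBall (0 : ℝ) 2) ?_
      intro z hz
      simp only [Metric.mem_closedBall, dist_zero_right, not_le, Real.norm_eq_abs] at hz
      rw [QQ_large (by rw [← sq_abs]; nlinarith), mul_zero]
  have := integral_Ioi_of_hasDerivAt_of_tendsto' hd hint hlim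
  simp only [finrank_euclideanSpace_fin, smul_eq_mul]
  norm_num at this ⊢
  rw [this, kk_one (by norm_num)]
  simp only [mul_one]
  exact ENNReal.toReal_pos (Metric.measure_ball_pos _ _ one_pos).ne' measure_ball_lt_top.ne

lemma QQ_scale (q s : ℝ) (hq : 0 < q) (hs : 0 ≤ s) :
    (2 * deriv (fun s => kk (q ^ 2 * s)) s + 4 * s * deriv (deriv (fun s => kk (q ^ 2 * s))) s) / √s
      = q ^ 3 * QQ (q ^ 2 * s) := by
  have p : ∀ s, HasDerivAt (fun s : ℝ => q ^ 2 * s) (q ^ 2) s := fun s => by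
    simpa using (hasDerivAt_id s).const_mul (q ^ 2)
  have e1 : deriv (fun s => kk (q ^ 2 * s)) = fun s => deriv kk (q ^ 2 * s) * q ^ 2 := by
    funext s
    exact ((kk_hasDeriv _).comp s (p s)).deriv
  have e2 : deriv (fun s => deriv kk (q ^ 2 * s) * q ^ 2) s
      = deriv (deriv kk) (q ^ 2 * s) * q ^ 2 * q ^ 2 :=
    (((dkk_hasDeriv _).comp s (p s)).mul_const (q ^ 2)).deriv
  rw [e1, e2]
  unfold QQ
  rw [Real.sqrt_mul (by positivity), Real.sqrt_sq hq.le]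
  rcases hs.eq_or_lt with rfl | hs
  · simp
  · have : 0 < √s := Real.sqrt_pos.2 hs
    field_simp

lemma QQ_cov (u : E3 → ℝ) (x : E3) (q : ℝ) (hq : 0 < q) :
    ∫ y, u y * (q ^ 3 * QQ (q ^ 2 * ‖y - x‖ ^ 2)) = ∫ z, u (x + q⁻¹ • z) * QQ (‖z‖ ^ 2) := by
  have h1 := Measure.integral_comp_smul_of_nonneg (volume : Measure E3)
    (fun v => u (x + q⁻¹ • v) * QQ (‖v‖ ^ 2)) q (hR := hq.le)
  have h2 := integral_sub_right_eq_self (μ := (volume : Measure E3))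
    (fun v => u (x + q⁻¹ • (q • v)) * QQ (‖q • v‖ ^ 2)) x
  rw [h1] at h2
  have h3 : ∫ z, u (x + q⁻¹ • z) * QQ (‖z‖ ^ 2) = q ^ 3 *
    ∫ y, u (x + q⁻¹ • (q • (y - x))) * QQ (‖q • (y - x)‖ ^ 2) := by
    rw [h2]
    simp only [finrank_euclideanSpace_fin, smul_eq_mul]
    field_simp
  rw [h3, ← integral_const_mul]
  congr 1
  funext y
  rw [smul_smul, inv_mul_cancel₀ hq.ne', one_smul, norm_smul, mul_pow, Real.norm_eq_abs, sq_abs]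
  simp only [add_sub_cancel]
  ring

lemma two_scale (u : E3 → ℝ) (hu : ContDiff ℝ 2 u) (x : E3) (r : ℝ) (hr : 1 ≤ r) :
    (∫ z, u (x + r • z) * QQ (‖z‖ ^ 2)) - ∫ z, u (x + r⁻¹ • z) * QQ (‖z‖ ^ 2)
      = ∫ y, laplacian u y *
          ((kk ((r⁻¹) ^ 2 * ‖y - x‖ ^ 2) - kk (r ^ 2 * ‖y - x‖ ^ 2)) / ‖y - x‖) := by
  have hr0 : 0 < r := by linarith
  have hri : r⁻¹ ≤ 1 := inv_le_one_of_one_le₀ hr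
  have hri0 : 0 < r⁻¹ := inv_pos.2 hr0
  set l1 : ℝ → ℝ := fun s => kk (r⁻¹ ^ 2 * s) with hl1
  set l2 : ℝ → ℝ := fun s => kk (r ^ 2 * s) with hl2
  have cl1 : ContDiff ℝ 2 l1 := kk_contDiff.comp (contDiff_const.mul contDiff_id)
  have cl2 : ContDiff ℝ 2 l2 := kk_contDiff.comp (contDiff_const.mul contDiff_id)
  have cd : ∀ f : ℝ → ℝ, ContDiff ℝ 2 f → ContDiff ℝ 1 (deriv f) := fun f hf =>
    ((contDiff_succ_iff_deriv (n := 1)).1 (by simpa [one_add_one_eq_two] using hf)).2.2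
  have hmul : r⁻¹ ^ 2 * r ^ 2 = 1 := by field_simp
  obtain ⟨gC, g', g'', hg1, hg2, hg3⟩ := aux_profile (fun s => l1 s - l2 s) (r⁻¹ ^ 2)
    (by positivity) (cl1.sub cl2) (by
      intro s hs
      have a2 : r ^ 2 * s ≤ 1 := by
        have := mul_le_mul_of_nonneg_left hs.le (by positivity : 0 ≤ r ^ 2)
        linarith
      have a1 : r⁻¹ ^ 2 * s ≤ 1 := by
        have h1 : r⁻¹ ^ 2 ≤ 1 := pow_le_one₀ hri0.le hri
        rcases le_or_gt s 0 with h | h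
        · nlinarith [sq_nonneg r⁻¹]
        · nlinarith [sq_nonneg r⁻¹]
      simp only [hl1, hl2, kk_one a1, kk_one a2, sub_self])
  have hd1 : deriv (fun s => l1 s - l2 s) = fun s => deriv l1 s - deriv l2 s := by
    funext s
    exact ((cl1.differentiable (by norm_num) s).hasDerivAt.sub
      (cl2.differentiable (by norm_num) s).hasDerivAt).deriv
  have hd2 : ∀ s, deriv (fun s => deriv l1 s - deriv l2 s) s
      = deriv (deriv l1) s - deriv (deriv l2) s := by
    intro s
    exact (((cd _ cl1).differentiable (by norm_num) s).hasDerivAt.sub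
      ((cd _ cl2).differentiable (by norm_num) s).hasDerivAt).deriv
  have hw : ContDiff ℝ 2 (fun y : E3 => (fun s => (l1 s - l2 s) / √s) (‖y - x‖ ^ 2)) :=
    gC.comp ((contDiff_id.sub contDiff_const).norm_sq ℝ)
  have hc : HasCompactSupport (fun y : E3 => (fun s => (l1 s - l2 s) / √s) (‖y - x‖ ^ 2)) := by
    refine HasCompactSupport.intro (isCompact_closedBall x (2 * r)) ?_
    intro y hy
    simp only [Metric.mem_closedBall, not_le, dist_eq_norm] at hy
    have b1 : 2 * r ^ 2 ≤ ‖y - x‖ ^ 2 := by nlinarith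
    have b2 : 2 ≤ r⁻¹ ^ 2 * ‖y - x‖ ^ 2 := by
      have := mul_le_mul_of_nonneg_left b1 (sq_nonneg r⁻¹)
      nlinarith
    have b3 : 2 ≤ r ^ 2 * ‖y - x‖ ^ 2 := by
      have : 1 ≤ r ^ 2 := one_le_pow₀ hr
      nlinarith
    simp only [hl1, hl2, kk_zero b2, kk_zero b3, sub_self, zero_div]
  have G := aux_green u _ hu hw hc
  have L : ∀ y, laplacian (fun y : E3 => (fun s => (l1 s - l2 s) / √s) (‖y - x‖ ^ 2)) y
      = r⁻¹ ^ 3 * QQ (r⁻¹ ^ 2 * ‖y - x‖ ^ 2) - r ^ 3 * QQ (r ^ 2 * ‖y - x‖ ^ 2) := by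
    intro y
    rw [aux_radial x (fun s => (l1 s - l2 s) / √s) g' g'' hg1 hg2 y, hg3, hd1, hd2,
      ← QQ_scale r⁻¹ _ hri0 (by positivity), ← QQ_scale r _ hr0 (by positivity)]
    ring
  simp only [L] at G
  have icov : ∀ q : ℝ, 0 < q → Integrable
      (fun y => u y * (q ^ 3 * QQ (q ^ 2 * ‖y - x‖ ^ 2))) := by
    intro q hq
    refine Continuous.integrable_of_hasCompactSupport ?_ ?_
    · have := hu.continuous
      have := QQ_cont
      fun_prop
    · refine HasCompactSupport.intro (isCompact_closedBall x (2 * q⁻¹)) ?_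
      intro y hy
      simp only [Metric.mem_closedBall, not_le, dist_eq_norm] at hy
      have : 2 < q * ‖y - x‖ := by
        have := mul_lt_mul_of_pos_left hy hq
        field_simp at this
        linarith
      rw [QQ_large (by nlinarith)]
      simp
  have c1 := QQ_cov u x r⁻¹ hri0
  have c2 := QQ_cov u x r hr0
  rw [inv_inv] at c1
  rw [← c1, ← c2, ← integral_sub (icov _ hri0) (icov _ hr0)]
  simp only [hl1, hl2, Real.sqrt_sq (norm_nonneg _)] at G
  rw [← G]
  congr 1
  funext y
  ring

lemma aux_rep (u : E3 → ℝ) (hu : ContDiff ℝ 2 u)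
    (ht : Tendsto u (cocompact E3) (nhds 0)) (R2 : ℝ)
    (hlap : ∀ y : E3, R2 < ‖y‖ → laplacian u y = 0) (x : E3) (hx : R2 < ‖x‖) :
    ∫ y, laplacian u y / ‖y - x‖ = - (∫ z : E3, QQ (‖z‖ ^ 2)) * u x := by
  obtain ⟨B, hB⟩ : ∃ B, ∀ y, ‖u y‖ ≤ B := by
    have h1 : ∀ᶠ y in cocompact E3, ‖u y‖ ≤ 1 := by
      filter_upwards [ht.norm.eventually (gt_mem_nhds (by simp : ‖(0:ℝ)‖ < 1))] with y hy
      exact hy.le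
    obtain ⟨K, hK, hKs⟩ := mem_cocompact.1 h1
    obtain ⟨B, hB⟩ := hK.exists_bound_of_continuousOn hu.continuous.continuousOn
    refine ⟨max B 1, fun y => ?_⟩
    by_cases hy : y ∈ K
    · exact (hB y hy).trans (le_max_left _ _)
    · exact (hKs hy : ‖u y‖ ≤ 1).trans (le_max_right _ _)
  have hcu := hu.continuous
  have hbd : Integrable (fun z : E3 => B * ‖QQ (‖z‖ ^ 2)‖) := QQn_int.norm.const_mul B
  have hmeas : ∀ r : ℝ, AEStronglyMeasurable (fun z : E3 => u (x + r • z) * QQ (‖z‖ ^ 2)) volume := by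
    intro r
    have := QQn_cont
    exact Continuous.aestronglyMeasurable (by fun_prop)
  have hle : ∀ (r : ℝ) (z : E3), ‖u (x + r • z) * QQ (‖z‖ ^ 2)‖ ≤ B * ‖QQ (‖z‖ ^ 2)‖ := by
    intro r z
    rw [norm_mul]
    exact mul_le_mul_of_nonneg_right (hB _) (norm_nonneg _)
  have t1 : Tendsto (fun r : ℝ => ∫ z, u (x + r • z) * QQ (‖z‖ ^ 2)) atTop (nhds 0) := by
    have : (0:ℝ) = ∫ z : E3, (0:ℝ) := by simp
    rw [this]
    refine tendsto_integral_filter_of_dominated_convergence _ (Eventually.of_forall hmeas)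
      (Eventually.of_forall fun r => ae_of_all _ (hle r)) hbd (ae_of_all _ fun z => ?_)
    by_cases hz : z = 0
    · subst hz
      have : QQ (‖(0:E3)‖ ^ 2) = 0 := QQ_small (by simp)
      simp only [this, mul_zero]
      exact tendsto_const_nhds
    · have hz' : 0 < ‖z‖ := norm_pos_iff.2 hz
      have h2 : Tendsto (fun r : ℝ => x + r • z) atTop (cocompact E3) := by
        rw [← Metric.cobounded_eq_cocompact, ← tendsto_norm_atTop_iff_cobounded]
        have h3 : Tendsto (fun r : ℝ => r * ‖z‖ - ‖x‖) atTop atTop :=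
          tendsto_atTop_add_const_right _ _ (tendsto_id.atTop_mul_const hz')
        refine tendsto_atTop_mono' _ ?_ h3
        filter_upwards [eventually_ge_atTop 0] with r hr
        have := norm_sub_le (x + r • z) x
        rw [add_sub_cancel_left, norm_smul, Real.norm_of_nonneg hr] at this
        linarith
      simpa using (ht.comp h2).mul_const (QQ (‖z‖ ^ 2))
  have t2 : Tendsto (fun r : ℝ => ∫ z, u (x + r⁻¹ • z) * QQ (‖z‖ ^ 2)) atTop
      (nhds (∫ z : E3, u x * QQ (‖z‖ ^ 2))) := by
    refine tendsto_integral_filter_of_dominated_convergence _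
      (Eventually.of_forall fun r => hmeas r⁻¹)
      (Eventually.of_forall fun r => ae_of_all _ (hle r⁻¹)) hbd (ae_of_all _ fun z => ?_)
    have h3 : Tendsto (fun r : ℝ => x + r⁻¹ • z) atTop (nhds x) := by
      simpa using ((tendsto_inv_atTop_zero (𝕜 := ℝ)).smul_const z).const_add x
    exact ((hcu.tendsto x).comp h3).mul_const _
  have t3 := t1.sub t2
  have t4 : Tendsto (fun r : ℝ => (∫ z, u (x + r • z) * QQ (‖z‖ ^ 2)) -
      ∫ z, u (x + r⁻¹ • z) * QQ (‖z‖ ^ 2)) atTop (nhds (∫ y, laplacian u y / ‖y - x‖)) := by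
    refine tendsto_const_nhds.congr' ?_
    have hδ : 0 < ‖x‖ - R2 := by linarith
    filter_upwards [eventually_ge_atTop 1, eventually_ge_atTop (‖x‖ + R2),
      eventually_ge_atTop (2 / (‖x‖ - R2))] with r hr1 hr2 hr3
    rw [two_scale u hu x r hr1]
    congr 1
    funext y
    rcases lt_or_ge R2 ‖y‖ with hy | hy
    · rw [hlap y hy]
      simp
    · have n1 : ‖y - x‖ ≤ r := (norm_sub_le _ _).trans (by linarith)
      have n2 : ‖x‖ - R2 ≤ ‖y - x‖ := by
        have := norm_sub_norm_le x y
        rw [norm_sub_rev] at this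
        linarith
      have hr0 : 0 < r := by linarith
      have n3 : 2 ≤ r * ‖y - x‖ := by
        rw [div_le_iff₀ hδ] at hr3
        nlinarith
      rw [kk_one, kk_zero]
      · ring
      · nlinarith
      · have : r⁻¹ * ‖y - x‖ ≤ 1 := by
          rw [inv_mul_le_iff₀ hr0]
          linarith
        have h0 : 0 ≤ r⁻¹ * ‖y - x‖ := by positivity
        rw [← mul_pow]
        exact pow_le_one₀ h0 this
  have := tendsto_nhds_unique t4 t3
  rw [this, integral_const_mul]
  ring

lemma aux_invnorm (y x : E3) (hx : x ≠ y) :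
    HasFDerivAt (fun x : E3 => ‖x - y‖⁻¹) (-(‖x - y‖ ^ 3)⁻¹ • innerSL ℝ (x - y)) x := by
  have hn : HasFDerivAt (fun x : E3 => ‖x - y‖ ^ 2) (2 • innerSL ℝ (x - y)) x := by
    simpa using ((hasFDerivAt_id x).sub_const y).norm_sq
  have hp : 0 < ‖x - y‖ := norm_pos_iff.2 (sub_ne_zero.2 hx)
  have h1 := HasFDerivAt.sqrt hn (by positivity)
  simp only [Real.sqrt_sq (norm_nonneg _)] at h1
  have h3 : HasFDerivAt (𝕜 := ℝ) (fun x : E3 => ‖x - y‖⁻¹) _ x :=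
    (hasDerivAt_inv hp.ne').comp_hasFDerivAt x h1
  convert! h3 using 1
  ext v
  simp
  field_simp

lemma aux_D1 (R : ℝ) (hR : 0 < R) (y x : E3) (hy : ‖y‖ ≤ 3 / 2 * R) (hx : 15 / 8 * R ≤ ‖x‖) :
    ‖x‖ / 5 ≤ ‖x - y‖ ∧ ‖‖x - y‖⁻¹ - ‖x‖⁻¹‖ ≤ 8 * R / ‖x‖ ^ 2 ∧
    ‖-(‖x - y‖ ^ 3)⁻¹ • (x - y) + (‖x‖ ^ 3)⁻¹ • x‖ ≤ 48 * R / ‖x‖ ^ 3 := by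
  have hX : 0 < ‖x‖ := by linarith
  have h5 : ‖x‖ / 5 ≤ ‖x - y‖ := by
    have := norm_sub_norm_le x y
    linarith
  have hd : |‖x‖ - ‖x - y‖| ≤ ‖y‖ := by
    have := abs_norm_sub_norm_le x (x - y)
    simpa using this
  have hxy : x - (x - y) = y := by abel
  refine ⟨h5, ?_, ?_⟩
  · have hZ : 0 < ‖x - y‖ := by linarith
    rw [Real.norm_eq_abs]
    have : ‖x - y‖⁻¹ - ‖x‖⁻¹ = (‖x‖ - ‖x - y‖) / (‖x‖ * ‖x - y‖) := by field_simp
    rw [this, abs_div, abs_of_pos (by positivity : 0 < ‖x‖ * ‖x - y‖),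
      div_le_div_iff₀ (by positivity) (by positivity)]
    have a1 : |‖x‖ - ‖x - y‖| ≤ 3 / 2 * R := hd.trans hy
    have a2 : |‖x‖ - ‖x - y‖| * ‖x‖ ^ 2 ≤ 3 / 2 * R * ‖x‖ ^ 2 :=
      mul_le_mul_of_nonneg_right a1 (by positivity)
    have a3 : 8 * R * ‖x‖ * (‖x‖ / 5) ≤ 8 * R * ‖x‖ * ‖x - y‖ :=
      mul_le_mul_of_nonneg_left h5 (by positivity)
    have : 0 ≤ R * ‖x‖ ^ 2 := by positivity
    nlinarith
  · have hZ : 0 < ‖x - y‖ := by linarith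
    set z := x - y with hz
    have e : -(‖z‖ ^ 3)⁻¹ • z + (‖x‖ ^ 3)⁻¹ • x
        = (‖x‖ ^ 3)⁻¹ • y + ((‖x‖ ^ 3)⁻¹ - (‖z‖ ^ 3)⁻¹) • z := by
      have : y = x - z := by rw [hz]; abel
      rw [this]
      module
    rw [e]
    refine (norm_add_le _ _).trans ?_
    rw [norm_smul, norm_smul, Real.norm_of_nonneg (by positivity : 0 ≤ (‖x‖ ^ 3)⁻¹), Real.norm_eq_abs]
    have f1 : (‖x‖ ^ 3)⁻¹ - (‖z‖ ^ 3)⁻¹ = -(‖x‖ - ‖z‖) *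
        ((‖z‖ ^ 2 + ‖z‖ * ‖x‖ + ‖x‖ ^ 2) / (‖x‖ ^ 3 * ‖z‖ ^ 3)) := by
      field_simp
      ring
    rw [f1, abs_mul, abs_neg, abs_of_nonneg (by positivity :
      0 ≤ ((‖z‖ ^ 2 + ‖z‖ * ‖x‖ + ‖x‖ ^ 2) / (‖x‖ ^ 3 * ‖z‖ ^ 3)))]
    have f2 : (‖z‖ ^ 2 + ‖z‖ * ‖x‖ + ‖x‖ ^ 2) / (‖x‖ ^ 3 * ‖z‖ ^ 3) * ‖z‖ ≤ 31 * (‖x‖ ^ 3)⁻¹ := by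
      have : (‖z‖ ^ 2 + ‖z‖ * ‖x‖ + ‖x‖ ^ 2) / (‖x‖ ^ 3 * ‖z‖ ^ 3) * ‖z‖
        = (‖z‖ ^ 2 + ‖z‖ * ‖x‖ + ‖x‖ ^ 2) / ‖z‖ ^ 2 * (‖x‖ ^ 3)⁻¹ := by
        field_simp
      rw [this]
      refine mul_le_mul_of_nonneg_right ?_ (by positivity)
      rw [div_le_iff₀ (by positivity)]
      nlinarith
    calc (‖x‖ ^ 3)⁻¹ * ‖y‖ + |‖x‖ - ‖z‖| *
          ((‖z‖ ^ 2 + ‖z‖ * ‖x‖ + ‖x‖ ^ 2) / (‖x‖ ^ 3 * ‖z‖ ^ 3)) * ‖z‖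
        = (‖x‖ ^ 3)⁻¹ * ‖y‖ + |‖x‖ - ‖z‖| *
          ((‖z‖ ^ 2 + ‖z‖ * ‖x‖ + ‖x‖ ^ 2) / (‖x‖ ^ 3 * ‖z‖ ^ 3) * ‖z‖) := by ring
      _ ≤ (‖x‖ ^ 3)⁻¹ * (3 / 2 * R) + (3 / 2 * R) * (31 * (‖x‖ ^ 3)⁻¹) := by
          gcongr
          exact hd.trans hy
      _ = 48 * R / ‖x‖ ^ 3 := by
          field_simp
          ring

lemma aux_near (R : ℝ) (x x' : E3) (hx : 2 * R ≤ ‖x‖)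
    (hx' : x' ∈ Metric.ball x (R / 8)) : 15 / 8 * R ≤ ‖x'‖ ∧ 15 / 16 * ‖x‖ ≤ ‖x'‖ := by
  rw [mem_ball_iff_norm] at hx'
  have := norm_sub_norm_le x x'
  rw [norm_sub_rev] at this
  constructor <;> linarith

lemma aux_D2 (R : ℝ) (hR : 0 < R) (y x x' : E3) (hy : ‖y‖ ≤ 3 / 2 * R) (hx : 2 * R ≤ ‖x‖)
    (hx' : x' ∈ Metric.ball x (R / 8)) :
    ‖(‖x' - y‖⁻¹ - ‖x'‖⁻¹) - (‖x - y‖⁻¹ - ‖x‖⁻¹)‖ ≤ 96 * R / ‖x‖ ^ 3 * ‖x' - x‖ := by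
  have hX : 0 < ‖x‖ := by linarith
  refine Convex.norm_image_sub_le_of_norm_hasFDerivWithin_le
    (f := fun x : E3 => ‖x - y‖⁻¹ - ‖x‖⁻¹)
    (f' := fun x => innerSL ℝ (-(‖x - y‖ ^ 3)⁻¹ • (x - y) + (‖x‖ ^ 3)⁻¹ • x))
    (s := Metric.ball x (R / 8)) ?_ ?_ (convex_ball _ _) (Metric.mem_ball_self (by positivity)) hx'
  · intro w hw
    obtain ⟨n1, n2⟩ := aux_near R x w hx hw
    have hw0 : 0 < ‖w‖ := by linarith
    have h5 := (aux_D1 R hR y w hy n1).1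
    have hwy : w ≠ y := by
      rintro rfl
      simp at h5
      linarith
    have d1 := aux_invnorm y w hwy
    have d2 := aux_invnorm 0 w (norm_pos_iff.1 hw0)
    simp only [sub_zero] at d2
    have d3 := d1.sub d2
    refine HasFDerivAt.hasFDerivWithinAt ?_
    convert! d3 using 1
    ext v
    simp
  · intro w hw
    obtain ⟨n1, n2⟩ := aux_near R x w hx hw
    rw [innerSL_apply_norm]
    have hw0 : 0 < ‖w‖ := by linarith
    refine (aux_D1 R hR y w hy n1).2.2.trans ?_
    have h3 : (15 / 16 * ‖x‖) ^ 3 ≤ ‖w‖ ^ 3 := by gcongr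
    rw [div_le_div_iff₀ (by positivity) (by positivity)]
    have : 0 < R * ‖x‖ ^ 3 := by positivity
    have h4 : R * (15 / 16 * ‖x‖) ^ 3 ≤ R * ‖w‖ ^ 3 := by gcongr
    ring_nf at h4 this ⊢
    nlinarith

lemma laplacian_congr {f g : E3 → ℝ} {x : E3} (hfg : f =ᶠ[nhds x] g) :
    laplacian f x = laplacian g x := by
  unfold laplacian
  refine Finset.sum_congr rfl fun i _ => ?_
  have : (fun y => fderiv ℝ f y (EuclideanSpace.single i (1 : ℝ))) =ᶠ[nhds x]
      fun y => fderiv ℝ g y (EuclideanSpace.single i (1 : ℝ)) := by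
    filter_upwards [hfg.fderiv (𝕜 := ℝ)] with y hy
    rw [hy]
  rw [this.fderiv_eq]

lemma laplacian_sub_const (f : E3 → ℝ) (a : ℝ) (x : E3) :
    laplacian (fun y => f y - a) x = laplacian f x := by
  unfold laplacian
  simp only [fderiv_sub_const]

lemma laplacian_cont (u : E3 → ℝ) (hu : ContDiff ℝ 2 u) : Continuous (laplacian u) := by
  unfold laplacian
  refine continuous_finsetSum _ fun i _ => ?_
  have h1 : ContDiff ℝ 1 (fun y => fderiv ℝ u y (EuclideanSpace.single i (1 : ℝ))) :=
    (hu.fderiv_right (m := 1) (by norm_num)).clm_apply contDiff_const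
  exact (h1.continuous_fderiv (by norm_num)).clm_apply continuous_const

lemma aux_cutoff (R a : ℝ) (hR : 0 < R) (h : E3 → ℝ)
    (hreg : ContDiffOn ℝ 2 h {x : E3 | R < ‖x‖}) :
    ∃ u : E3 → ℝ, ContDiff ℝ 2 u ∧ ∀ x, 3 / 2 * R ≤ ‖x‖ → u x = h x - a := by
  let χ : ContDiffBump (0 : E3) := ⟨5 / 4 * R, 3 / 2 * R, by linarith, by linarith⟩
  refine ⟨fun x => (1 - χ x) * (h x - a), ?_, ?_⟩
  · rw [contDiff_iff_contDiffAt]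
    intro x
    rcases lt_or_ge ‖x‖ (5 / 4 * R) with hx | hx
    · have : (fun x => (1 - χ x) * (h x - a)) =ᶠ[nhds x] fun _ => 0 := by
        filter_upwards [continuous_norm.continuousAt.eventually (gt_mem_nhds hx)] with y hy
        rw [χ.one_of_mem_closedBall (by simpa using hy.le)]
        simp
      exact contDiffAt_const.congr_of_eventuallyEq this
    · have ho : {x : E3 | R < ‖x‖} ∈ nhds x :=
        (isOpen_lt continuous_const continuous_norm).mem_nhds (by
          show R < ‖x‖
          linarith)
      exact (contDiffAt_const.sub χ.contDiffAt).mul ((hreg.contDiffAt ho).sub contDiffAt_const)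
  · intro x hx
    simp only
    rw [χ.zero_of_le_dist (by simpa using hx)]
    ring

/-- Spherical-harmonics expansion at infinity: a harmonic function on `{|x| > R}` in `ℝ³`
tending to a constant `a` at infinity satisfies `h(x) = a + b/|x| + O(1/|x|²)`, with the
gradient of the remainder being `O(1/|x|³)`. -/
theorem harmonic_expansion_at_infinity
    (R a : ℝ) (hR : 0 < R) (h : EuclideanSpace ℝ (Fin 3) → ℝ)
    (hreg : ContDiffOn ℝ 2 h {x : EuclideanSpace ℝ (Fin 3) | R < ‖x‖})
    (hharm : ∀ x : EuclideanSpace ℝ (Fin 3), R < ‖x‖ → laplacian h x = 0)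
    (hlim : Tendsto h (cocompact (EuclideanSpace ℝ (Fin 3))) (nhds a)) :
    ∃ b : ℝ, ∃ C > (0:ℝ), ∀ x : EuclideanSpace ℝ (Fin 3), 2 * R ≤ ‖x‖ →
      |h x - a - b / ‖x‖| ≤ C / ‖x‖ ^ 2 ∧
      ‖gradient (fun y : EuclideanSpace ℝ (Fin 3) => h y - a - b / ‖y‖) x‖ ≤ C / ‖x‖ ^ 3 := by
  obtain ⟨u, hu, huh⟩ := aux_cutoff R a hR h hreg
  have hlap : ∀ y : E3, 3 / 2 * R < ‖y‖ → laplacian u y = 0 := by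
    intro y hy
    have : u =ᶠ[nhds y] fun y => h y - a := by
      filter_upwards [continuous_norm.continuousAt.eventually (lt_mem_nhds hy)] with z hz
      exact huh z hz.le
    rw [laplacian_congr this, laplacian_sub_const]
    exact hharm y (by linarith)
  have ht : Tendsto u (cocompact E3) (nhds 0) := by
    have h1 : Tendsto (fun y => h y - a) (cocompact E3) (nhds 0) := by
      simpa using hlim.sub_const a
    refine h1.congr' ?_
    filter_upwards [(tendsto_norm_cocompact_atTop (E := E3)).eventually
      (eventually_ge_atTop (3 / 2 * R))] with y hy
    exact (huh y hy).symm
  set f := laplacian u with hf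
  have fc : Continuous f := laplacian_cont u hu
  have fi : Integrable f := by
    refine fc.integrable_of_hasCompactSupport ?_
    refine HasCompactSupport.intro (isCompact_closedBall (0 : E3) (3 / 2 * R)) fun y hy => ?_
    exact hlap y (by simpa using hy)
  set c := ∫ z : E3, QQ (‖z‖ ^ 2) with hc
  have cpos : 0 < c := QQ_pos
  have iD : ∀ x : E3, 15 / 8 * R ≤ ‖x‖ → Integrable (fun y => f y * (‖x - y‖⁻¹ - ‖x‖⁻¹)) := by
    intro x hx
    refine (fi.norm.mul_const (8 * R / ‖x‖ ^ 2)).mono' ?_ (ae_of_all _ fun y => ?_)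
    · have := fc.measurable
      exact Measurable.aestronglyMeasurable (by fun_prop)
    · rcases lt_or_ge (3 / 2 * R) ‖y‖ with hy | hy
      · simp [hlap y hy]
      · rw [norm_mul]
        exact mul_le_mul_of_nonneg_left (aux_D1 R hR y x hy hx).2.1 (norm_nonneg _)
  have rep : ∀ x : E3, 15 / 8 * R ≤ ‖x‖ →
      h x - a - (-(c⁻¹) * ∫ y, f y) / ‖x‖ = -(c⁻¹) * ∫ y, f y * (‖x - y‖⁻¹ - ‖x‖⁻¹) := by
    intro x hx
    have h1 := aux_rep u hu ht (3 / 2 * R) hlap x (by linarith)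
    have h2 : ∫ y, f y / ‖y - x‖ =
        (∫ y, f y * (‖x - y‖⁻¹ - ‖x‖⁻¹)) + (∫ y, f y) * ‖x‖⁻¹ := by
      rw [← integral_mul_const, ← integral_add (iD x hx) (fi.mul_const _)]
      congr 1
      funext y
      rw [norm_sub_rev]
      ring
    rw [← hf, ← hc, h2, huh x (by linarith)] at h1
    have h3 : h x - a = -(c⁻¹) * ((∫ y, f y * (‖x - y‖⁻¹ - ‖x‖⁻¹)) + (∫ y, f y) * ‖x‖⁻¹) := by
      rw [h1]
      field_simp
    rw [h3]
    ring
  set I := ∫ y, ‖f y‖ with hI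
  have I0 : 0 ≤ I := integral_nonneg fun y => norm_nonneg _
  refine ⟨-(c⁻¹) * ∫ y, f y, c⁻¹ * (I * (96 * R)) + 1, by positivity, fun x hx => ⟨?_, ?_⟩⟩
  · have hX : 0 < ‖x‖ := by linarith
    rw [rep x (by linarith), abs_mul, abs_neg, abs_of_pos (inv_pos.2 cpos)]
    have h1 : ‖∫ y, f y * (‖x - y‖⁻¹ - ‖x‖⁻¹)‖ ≤ ∫ y, ‖f y‖ * (8 * R / ‖x‖ ^ 2) := by
      refine norm_integral_le_of_norm_le (fi.norm.mul_const _) (ae_of_all _ fun y => ?_)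
      rcases lt_or_ge (3 / 2 * R) ‖y‖ with hy | hy
      · simp [hlap y hy]
      · rw [norm_mul]
        exact mul_le_mul_of_nonneg_left (aux_D1 R hR y x hy (by linarith)).2.1 (norm_nonneg _)
    rw [integral_mul_const, Real.norm_eq_abs] at h1
    calc c⁻¹ * |∫ y, f y * (‖x - y‖⁻¹ - ‖x‖⁻¹)| ≤ c⁻¹ * (I * (8 * R / ‖x‖ ^ 2)) := by gcongr
      _ = (c⁻¹ * (I * (8 * R))) / ‖x‖ ^ 2 := by ring
      _ ≤ _ := by
        gcongr
        have : c⁻¹ * (I * (8 * R)) ≤ c⁻¹ * (I * (96 * R)) := by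
          gcongr
          norm_num
        linarith
  · have hX : 0 < ‖x‖ := by linarith
    unfold gradient
    rw [LinearIsometryEquiv.norm_map]
    refine norm_fderiv_le_of_lip' ℝ (by positivity) ?_
    filter_upwards [Metric.ball_mem_nhds x (by positivity : 0 < R / 8)] with x' hx'
    have n1 := (aux_near R x x' hx hx').1
    rw [rep x (by linarith), rep x' n1, ← mul_sub,
      ← integral_sub (iD x' n1) (iD x (by linarith)), norm_mul, norm_neg,
      Real.norm_of_nonneg (inv_pos.2 cpos).le]
    have h1 : ‖∫ y, (f y * (‖x' - y‖⁻¹ - ‖x'‖⁻¹) - f y * (‖x - y‖⁻¹ - ‖x‖⁻¹))‖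
        ≤ ∫ y, ‖f y‖ * (96 * R / ‖x‖ ^ 3 * ‖x' - x‖) := by
      refine norm_integral_le_of_norm_le (fi.norm.mul_const _) (ae_of_all _ fun y => ?_)
      rcases lt_or_ge (3 / 2 * R) ‖y‖ with hy | hy
      · simp [hlap y hy]
      · rw [← mul_sub, norm_mul]
        exact mul_le_mul_of_nonneg_left (aux_D2 R hR y x x' hy hx hx') (norm_nonneg _)
    rw [integral_mul_const] at h1
    calc _ ≤ c⁻¹ * (I * (96 * R / ‖x‖ ^ 3 * ‖x' - x‖)) := by gcongr
      _ = (c⁻¹ * (I * (96 * R))) / ‖x‖ ^ 3 * ‖x' - x‖ := by ring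
      _ ≤ _ := by
        gcongr
        linarith
end

section
/- Let K ⊂ ℝ³ be the closure of a nonempty bounded open set with ℝ³ \ K connected, and let L > 0. Suppose h is continuous on ℝ³ \ int(K), harmonic on ℝ³ \ K, h = 0 on ∂K, and lim_{|x|→∞} h(x) = −L. Then −L < h(x) < 0 for every x ∈ ℝ³ \ K. -/
open Real Filter MeasureTheory

/-- Second derivative test along a line. -/
theorem line_test {n : ℕ} (f φ : EuclideanSpace ℝ (Fin n) → ℝ) (p e : EuclideanSpace ℝ (Fin n))
    (A B C : ℝ) (hf : ContDiffAt ℝ 2 f p)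
    (hφ : ∀ t : ℝ, φ (p + t • e) = A + B * t + C * t ^ 2)
    (hmax : IsLocalMax (fun x => f x + φ x) p) :
    fderiv ℝ (fun y => fderiv ℝ f y e) p e + 2 * C ≤ 0 := by
  by_contra hpos
  push Not at hpos
  set g : ℝ → ℝ := fun t => f (p + t • e) + (A + B * t + C * t ^ 2) with hg
  have hline : ∀ t : ℝ, HasDerivAt (fun t : ℝ => p + t • e) e t := by
    intro t
    simpa using ((hasDerivAt_id t).smul_const e).const_add p
  have hcl : Tendsto (fun t : ℝ => p + t • e) (nhds 0) (nhds p) := by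
    have := (hline 0).continuousAt.tendsto
    simpa using this
  have hquad : ∀ t : ℝ, HasDerivAt (fun t : ℝ => A + B * t + C * t ^ 2) (B + 2 * C * t) t := by
    intro t
    have h1 := (((hasDerivAt_id t).const_mul B).const_add A).add
      (((hasDerivAt_id t).pow 2).const_mul C)
    refine h1.congr_deriv ?_
    simp
    ring
  have hev : ∀ᶠ x in nhds p, DifferentiableAt ℝ f x := by
    filter_upwards [hf.eventually (by simp)] with x hx
    exact hx.differentiableAt (by norm_num)
  have hd1 : ∀ᶠ t in nhds (0 : ℝ), HasDerivAt g (fderiv ℝ f (p + t • e) e + (B + 2 * C * t)) t := by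
    filter_upwards [hcl.eventually hev] with t ht
    exact (ht.hasFDerivAt.comp_hasDerivAt t (hline t)).add (hquad t)
  have hd1' : deriv g =ᶠ[nhds 0] fun t => fderiv ℝ f (p + t • e) e + (B + 2 * C * t) := by
    filter_upwards [hd1] with t ht using ht.deriv
  have hdf : DifferentiableAt ℝ (fun y => fderiv ℝ f y e) p := by
    have h1 : ContDiffAt ℝ 1 (fderiv ℝ f) p := hf.fderiv_right (by norm_num)
    exact (h1.differentiableAt (by norm_num)).clm_apply (differentiableAt_const e)
  have hd2 : HasDerivAt (fun t => fderiv ℝ f (p + t • e) e + (B + 2 * C * t))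
      (fderiv ℝ (fun y => fderiv ℝ f y e) p e + 2 * C) 0 := by
    have h0 : HasFDerivAt (fun y => fderiv ℝ f y e) (fderiv ℝ (fun y => fderiv ℝ f y e) p)
        (p + (0 : ℝ) • e) := by simpa using hdf.hasFDerivAt
    have h1 := h0.comp_hasDerivAt (0 : ℝ) (hline 0)
    have h2 : HasDerivAt (fun t : ℝ => B + 2 * C * t) (2 * C) 0 := by
      simpa using ((hasDerivAt_id (0 : ℝ)).const_mul (2 * C)).const_add B
    exact h1.add h2
  have hdd : deriv (deriv g) 0 = fderiv ℝ (fun y => fderiv ℝ f y e) p e + 2 * C := by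
    rw [hd1'.deriv_eq]
    exact hd2.deriv
  have hgmax : IsLocalMax g 0 := by
    have := hcl.eventually hmax
    filter_upwards [this] with t ht
    have h0 := hφ 0
    rw [hφ] at ht
    simp only [zero_smul, add_zero] at h0
    simp only [hg, zero_smul, add_zero]
    rw [h0] at ht
    exact ht
  have hgmin : IsLocalMin g 0 :=
    isLocalMin_of_deriv_deriv_pos (by rw [hdd]; exact hpos) hgmax.deriv_eq_zero
      hd1.self_of_nhds.continuousAt
  have hconst : g =ᶠ[nhds 0] fun _ => g 0 := by
    filter_upwards [hgmax, hgmin] with t h1 h2 using le_antisymm h1 h2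
  have : deriv (deriv g) 0 = 0 := by
    rw [hconst.deriv.deriv_eq]
    simp
  linarith

/-- No touching: the key local step of the strong maximum principle. -/
theorem no_touch (Ω : Set (EuclideanSpace ℝ (Fin 3))) (hΩ : IsOpen Ω)
    (h : EuclideanSpace ℝ (Fin 3) → ℝ) (hreg : ContDiffOn ℝ 2 h Ω)
    (hharm : ∀ x ∈ Ω, laplacian h x = 0) (M : ℝ) (hM : ∀ x ∈ Ω, h x ≤ M)
    (y z : EuclideanSpace ℝ (Fin 3)) (hz : z ∈ Ω) (hzM : h z = M) (hzy : z ≠ y)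
    (hball : ∀ x, dist x y < dist z y → x ∈ Ω → h x < M) : False := by
  set v := z - y with hv
  have hv0 : 0 < ‖v‖ := norm_pos_iff.2 (sub_ne_zero.2 hzy)
  set q : EuclideanSpace ℝ (Fin 3) → ℝ := fun x =>
    -(inner ℝ (x - z) v) - 2 * ‖x - z‖ ^ 2 + 8 * (inner ℝ (x - z) v) ^ 2 / ‖v‖ ^ 2 with hq
  have hqc : Continuous q := by rw [hq]; fun_prop
  obtain ⟨r, hr, hrΩ⟩ := Metric.isOpen_iff.1 hΩ z hz
  -- choose a radius
  obtain ⟨s, hs, hsr, hsv⟩ : ∃ s : ℝ, 0 < s ∧ s < r ∧ 8 * s ≤ ‖v‖ :=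
    ⟨min (r / 2) (‖v‖ / 8), by positivity, by
      have := min_le_left (r / 2) (‖v‖ / 8); linarith, by
      have := min_le_right (r / 2) (‖v‖ / 8); linarith⟩
  have hcb : Metric.closedBall z s ⊆ Ω :=
    (Metric.closedBall_subset_ball hsr).trans hrΩ
  have hcont : ContinuousOn h Ω := hreg.continuousOn
  -- the region `q ≥ 0` lies in the ball
  have hqball : ∀ x, dist x z = s → 0 ≤ q x → h x < M := by
    intro x hx hqx
    refine hball x ?_ (hcb (by simp [hx]))
    have hu : ‖x - z‖ = s := by rw [← dist_eq_norm]; exact hx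
    set a : ℝ := inner ℝ (x - z) v with ha
    have hab : |a| ≤ s * ‖v‖ := by
      rw [← hu]; exact abs_real_inner_le_norm _ _
    have hq' : 0 ≤ -a - 2 * s ^ 2 + 8 * a ^ 2 / ‖v‖ ^ 2 := by
      have := hqx
      simp only [hq, hu] at this
      exact this
    have h3 : 8 * a ^ 2 / ‖v‖ ^ 2 ≤ |a| := by
      rw [div_le_iff₀ (by positivity), ← sq_abs a]
      have : 8 * |a| ≤ ‖v‖ ^ 2 := by nlinarith
      nlinarith [abs_nonneg a]
    have h4 : a < 0 := by
      by_contra hcon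
      push Not at hcon
      rw [abs_of_nonneg hcon] at h3
      nlinarith
    rw [abs_of_neg h4] at h3
    have h5 : ‖x - y‖ ^ 2 = s ^ 2 + 2 * a + ‖v‖ ^ 2 := by
      have : x - y = (x - z) + v := by rw [hv]; abel
      rw [this, norm_add_sq_real, hu]
    rw [dist_eq_norm, dist_eq_norm]
    apply lt_of_pow_lt_pow_left₀ 2 (norm_nonneg _)
    rw [h5]
    nlinarith
  -- choose ε
  obtain ⟨ε, hε, hεs⟩ : ∃ ε : ℝ, 0 < ε ∧ ∀ x, dist x z = s → h x + ε * q x < M := by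
    set S := Metric.sphere z s ∩ {x | 0 ≤ q x} with hS
    have hSc : IsCompact S := (isCompact_sphere z s).inter_right (isClosed_le continuous_const hqc)
    have hSΩ : S ⊆ Ω := fun x hx => hcb (Metric.sphere_subset_closedBall hx.1)
    rcases S.eq_empty_or_nonempty with he | hne
    · refine ⟨1, one_pos, fun x hx => ?_⟩
      have : ¬ 0 ≤ q x := fun hc => by
        have : x ∈ S := ⟨hx, hc⟩
        rw [he] at this; exact this
      have := hM x (hcb (by simp [hx]))
      linarith
    · obtain ⟨x1, hx1, hmax1⟩ := hSc.exists_isMaxOn hne (hcont.mono hSΩ)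
      obtain ⟨x2, hx2, hmax2⟩ := hSc.exists_isMaxOn hne hqc.continuousOn
      have hlt : h x1 < M := hqball x1 hx1.1 hx1.2
      have hq2 : 0 ≤ q x2 := hx2.2
      refine ⟨(M - h x1) / (q x2 + 1), by apply div_pos <;> linarith, fun x hx => ?_⟩
      have hεp : 0 < (M - h x1) / (q x2 + 1) := by apply div_pos <;> linarith
      by_cases hc : 0 ≤ q x
      · have hxS : x ∈ S := ⟨hx, hc⟩
        have h1 : h x ≤ h x1 := hmax1 hxS
        have h2 : q x ≤ q x2 := hmax2 hxS
        have h3 : (M - h x1) / (q x2 + 1) * (q x2 + 1) = M - h x1 := by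
          field_simp
        nlinarith
      · have := hM x (hcb (by simp [hx]))
        nlinarith
  -- interior max
  obtain ⟨p, hp, hpmax⟩ := (isCompact_closedBall z s).exists_isMaxOn
    ⟨z, Metric.mem_closedBall_self hs.le⟩
    ((hcont.mono hcb).add (continuous_const.mul hqc).continuousOn : ContinuousOn
      (fun x => h x + ε * q x) _)
  have hqz : q z = 0 := by simp [hq]
  have hpz : M ≤ h p + ε * q p := by
    have : h z + ε * q z ≤ h p + ε * q p := hpmax (Metric.mem_closedBall_self hs.le)
    rw [hqz, hzM] at this
    linarith
  have hpb : p ∈ Metric.ball z s := by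
    rcases lt_or_eq_of_le (Metric.mem_closedBall.1 hp) with h1 | h1
    · exact h1
    · have := hεs p h1
      linarith
  have hloc : IsLocalMax (fun x => h x + ε * q x) p :=
    hpmax.isLocalMax (Filter.mem_of_superset (Metric.isOpen_ball.mem_nhds hpb)
      Metric.ball_subset_closedBall)
  have hpΩ := hcb hp
  have hcd : ContDiffAt ℝ 2 h p := hreg.contDiffAt (hΩ.mem_nhds hpΩ)
  have key : ∀ i : Fin 3, fderiv ℝ (fun y => fderiv ℝ h y (EuclideanSpace.single i (1 : ℝ))) p
      (EuclideanSpace.single i (1 : ℝ)) + 2 * (ε * (-2 + 8 * (v i) ^ 2 / ‖v‖ ^ 2)) ≤ 0 := by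
    intro i
    refine line_test h (fun x => ε * q x) p _ (ε * q p)
      (ε * (-(v i) - 4 * (p i - z i) + 16 * inner ℝ (p - z) v * v i / ‖v‖ ^ 2)) _ hcd ?_ hloc
    intro t
    have e1 : p + t • EuclideanSpace.single i (1 : ℝ) - z
        = (p - z) + t • EuclideanSpace.single i (1 : ℝ) := by abel
    have e2 : inner ℝ ((p - z) + t • EuclideanSpace.single i (1 : ℝ)) v
        = inner ℝ (p - z) v + t * v i := by
      rw [inner_add_left, inner_smul_left, EuclideanSpace.inner_single_left]
      simp
    have e3 : ‖(p - z) + t • EuclideanSpace.single i (1 : ℝ)‖ ^ 2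
        = ‖p - z‖ ^ 2 + 2 * t * (p i - z i) + t ^ 2 := by
      rw [norm_add_sq_real, inner_smul_right, EuclideanSpace.inner_single_right, norm_smul]
      simp
      ring
    simp only [hq, e1, e2, e3]
    ring
  have hl := hharm p hpΩ
  have hn : ‖v‖ ^ 2 = v 0 ^ 2 + v 1 ^ 2 + v 2 ^ 2 := by
    rw [EuclideanSpace.norm_sq_eq, Fin.sum_univ_three]; simp
  have hsum : 8 * (v 0) ^ 2 / ‖v‖ ^ 2 + 8 * (v 1) ^ 2 / ‖v‖ ^ 2 + 8 * (v 2) ^ 2 / ‖v‖ ^ 2 = 8 := by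
    rw [← add_div, ← add_div, div_eq_iff (by positivity), hn]
    ring
  unfold laplacian at hl
  rw [Fin.sum_univ_three] at hl
  have k0 := key 0
  have k1 := key 1
  have k2 := key 2
  nlinarith

theorem strong_max (Ω : Set (EuclideanSpace ℝ (Fin 3))) (hΩ : IsOpen Ω) (hc : IsPreconnected Ω)
    (h : EuclideanSpace ℝ (Fin 3) → ℝ) (hreg : ContDiffOn ℝ 2 h Ω)
    (hharm : ∀ x ∈ Ω, laplacian h x = 0) (M : ℝ) (hM : ∀ x ∈ Ω, h x ≤ M)
    (x₀ : EuclideanSpace ℝ (Fin 3)) (hx₀ : x₀ ∈ Ω) (hx₀M : h x₀ = M) :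
    ∀ x ∈ Ω, h x = M := by
  have hcont : ContinuousOn h Ω := hreg.continuousOn
  have hsub : Ω ⊆ {x | x ∈ Ω ∧ h x = M} := by
    apply hc.subset_of_closure_inter_subset
    · rw [Metric.isOpen_iff]
      rintro a ⟨ha, haM⟩
      obtain ⟨r, hr, hrΩ⟩ := Metric.isOpen_iff.1 hΩ a ha
      refine ⟨r / 2, by positivity, fun y hy => ?_⟩
      rw [Metric.mem_ball] at hy
      have hyΩ : y ∈ Ω := hrΩ (by rw [Metric.mem_ball]; linarith)
      refine ⟨hyΩ, ?_⟩
      by_contra hne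
      have hcb : Metric.closedBall y (dist a y) ⊆ Ω := by
        intro x hx
        apply hrΩ
        rw [Metric.mem_closedBall] at hx
        rw [Metric.mem_ball]
        have := dist_triangle x y a
        rw [dist_comm a y] at hx
        linarith
      have hcl : IsClosed (Metric.closedBall y (dist a y) ∩ h ⁻¹' {M}) :=
        (hcont.mono hcb).preimage_isClosed_of_isClosed Metric.isClosed_closedBall isClosed_singleton
      have hcomp : IsCompact (Metric.closedBall y (dist a y) ∩ h ⁻¹' {M}) :=
        (isCompact_closedBall y (dist a y)).of_isClosed_subset hcl Set.inter_subset_left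
      obtain ⟨z, ⟨hz1, hz2⟩, hzmin⟩ := hcomp.exists_isMinOn (f := fun x => dist x y)
        ⟨a, by simp, haM⟩ (by fun_prop)
      refine no_touch Ω hΩ h hreg hharm M hM y z (hcb hz1) hz2 ?_ ?_
      · rintro rfl; exact hne hz2
      · intro x hx hxΩ
        refine lt_of_le_of_ne (hM x hxΩ) fun hxM => ?_
        have : dist z y ≤ dist x y :=
          hzmin ⟨Metric.mem_closedBall.2 (hx.le.trans (Metric.mem_closedBall.1 hz1)), hxM⟩
        linarith
    · exact ⟨x₀, hx₀, hx₀, hx₀M⟩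
    · rintro x ⟨hx, hxΩ⟩
      refine ⟨hxΩ, ?_⟩
      have hca : ContinuousAt h x := hcont.continuousAt (hΩ.mem_nhds hxΩ)
      have hfr : ∃ᶠ w in nhds x, h w = M :=
        (mem_closure_iff_frequently.1 hx).mono fun w hw => hw.2
      by_contra hne
      exact hfr (hca.eventually_ne hne)
  exact fun x hx => (hsub hx).2

/-- One-sided exterior principle, with boundary value `b` and limit `l`. -/
theorem exterior_upper
    (K : Set (EuclideanSpace ℝ (Fin 3))) (hKc : IsCompact K) (hKn : (frontier K).Nonempty)
    (hconn : IsConnected Kᶜ)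
    (h : EuclideanSpace ℝ (Fin 3) → ℝ)
    (hcont : ContinuousOn h (interior K)ᶜ)
    (hreg : ContDiffOn ℝ 2 h Kᶜ)
    (hharm : ∀ x ∉ K, laplacian h x = 0) (b l : ℝ) (hbl : b ≠ l)
    (hbdry : ∀ x ∈ frontier K, h x = b)
    (hlim : Tendsto h (cocompact (EuclideanSpace ℝ (Fin 3))) (nhds l)) :
    ∀ x ∉ K, h x < max b l := by
  have hKo : IsOpen Kᶜ := hKc.isClosed.isOpen_compl
  have hKci : Kᶜ ∈ cocompact (EuclideanSpace ℝ (Fin 3)) := hKc.compl_mem_cocompact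
  have hsub : Kᶜ ⊆ (interior K)ᶜ := Set.compl_subset_compl.2 interior_subset
  -- a constant function is impossible
  have hnc : ∀ M : ℝ, ¬ ∀ x ∈ Kᶜ, h x = M := by
    intro M hM
    have h1 : l = M := by
      refine tendsto_nhds_unique hlim (tendsto_const_nhds.congr' ?_)
      filter_upwards [hKci] with x hx using (hM x hx).symm
    obtain ⟨w, hw⟩ := hKn
    have hwi : w ∈ (interior K)ᶜ := hw.2
    have hwc : w ∈ closure Kᶜ := by rw [closure_compl]; exact hwi
    have h2 : h w = M := by
      have hne : (nhdsWithin w Kᶜ).NeBot := mem_closure_iff_nhdsWithin_neBot.1 hwc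
      refine tendsto_nhds_unique ((hcont w hwi).mono hsub).tendsto (tendsto_const_nhds.congr' ?_)
      filter_upwards [self_mem_nhdsWithin] with x hx using (hM x hx).symm
    rw [hbdry w hw] at h2
    exact hbl (h2.trans h1.symm)
  have hle : ∀ x ∈ Kᶜ, h x ≤ max b l := by
    intro x₁ hx₁
    by_contra hlt
    push Not at hlt
    obtain ⟨x₀, hx₀, hx₀max⟩ := hcont.exists_isMaxOn' (isOpen_interior.isClosed_compl)
      (hsub hx₁) (by
        apply Filter.Eventually.filter_mono inf_le_left
        filter_upwards [hlim.eventually_lt_const ((le_max_right b l).trans_lt hlt)] with x hx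
          using hx.le)
    have hge : h x₁ ≤ h x₀ := hx₀max (hsub hx₁)
    have hx₀K : x₀ ∈ Kᶜ := by
      intro hxK
      have : h x₀ = b := hbdry x₀ ⟨subset_closure hxK, hx₀⟩
      have := le_max_left b l
      linarith
    exact hnc _ (strong_max Kᶜ hKo hconn.isPreconnected h hreg hharm (h x₀)
      (fun x hx => hx₀max (hsub hx)) x₀ hx₀K rfl)
  intro x hx
  refine lt_of_le_of_ne (hle x hx) fun heq => ?_
  exact hnc _ (strong_max Kᶜ hKo hconn.isPreconnected h hreg hharm _ hle x hx heq)

/-- Maximum principle on an exterior domain: if `K ⊂ ℝ³` is the closure of a nonempty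
bounded open set with connected complement, `L > 0`, and `h` is continuous on
`ℝ³ \ int K`, harmonic on `ℝ³ \ K`, vanishes on `∂K`, and tends to `-L` at infinity,
then `-L < h < 0` outside `K`. -/
theorem exterior_maximum_principle
    (K : Set (EuclideanSpace ℝ (Fin 3))) (L : ℝ) (hL : 0 < L)
    (hK : ∃ U : Set (EuclideanSpace ℝ (Fin 3)),
      U.Nonempty ∧ IsOpen U ∧ Bornology.IsBounded U ∧ K = closure U)
    (hconn : IsConnected Kᶜ)
    (h : EuclideanSpace ℝ (Fin 3) → ℝ)
    (hcont : ContinuousOn h (interior K)ᶜ)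
    (hreg : ContDiffOn ℝ 2 h Kᶜ)
    (hharm : ∀ x ∉ K, laplacian h x = 0)
    (hbdry : ∀ x ∈ frontier K, h x = 0)
    (hlim : Tendsto h (cocompact (EuclideanSpace ℝ (Fin 3))) (nhds (-L))) :
    ∀ x ∉ K, -L < h x ∧ h x < 0 := by
  obtain ⟨U, hUn, hUo, hUb, rfl⟩ := hK
  have hKc : IsCompact (closure U) := hUb.isCompact_closure
  have hKn : (frontier (closure U)).Nonempty := by
    rw [nonempty_frontier_iff]
    refine ⟨hUn.closure, fun hu => ?_⟩
    obtain ⟨x, hx⟩ := hconn.nonempty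
    rw [hu] at hx
    exact hx trivial
  have hup := exterior_upper _ hKc hKn hconn h hcont hreg hharm 0 (-L) (by linarith) hbdry hlim
  have hlo := exterior_upper _ hKc hKn hconn (fun x => - h x) hcont.neg hreg.neg
    (fun x hx => by
      have := hharm x hx
      unfold laplacian at this ⊢
      simp only [fderiv_fun_neg, neg_apply, Finset.sum_neg_distrib, this, neg_zero])
    0 L (by linarith) (fun x hx => by simp [hbdry x hx]) (by simpa using hlim.neg)
  intro x hx
  have h1 := hup x hx
  have h2 := hlo x hx
  rw [max_eq_left (by linarith)] at h1
  rw [max_eq_right hL.le] at h2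
  exact ⟨by linarith, h1⟩
end
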